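/- Let C > 0 and t₁ < 0. There is no differentiable function y : (−∞, t₁] → ℝ such that 0 < y(t) < 1 and y′(t) ≥ C (1 − y(t)²) (−t)^{−2/3} for all t ≤ t₁. -/

import Mathlib

/-- Integral estimate in the proof of Lemma 3.1: no differentiable function
`y : (-∞, t₁] → ℝ` can satisfy `0 < y < 1` and
`y' ≥ C (1 - y²) (-t)^{-2/3}` on all of `(-∞, t₁]`. -/
theorem stmt_12 (C t₁ : ℝ) (hC : 0 < C) (ht₁ : t₁ < 0) :
    ¬ ∃ y y' : ℝ → ℝ, ∀ t ≤ t₁,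
      HasDerivWithinAt y (y' t) (Set.Iic t₁) t ∧
      0 < y t ∧ y t < 1 ∧
      C * (1 - (y t) ^ 2) * (-t) ^ (-(2 : ℝ) / 3) ≤ y' t := by
  rintro ⟨y, y', h⟩
  let g : ℝ → ℝ := fun t =>
    Real.log (1 + y t) - Real.log (1 - y t) + 6 * C * (-t) ^ ((1 : ℝ) / 3)
  -- `g = 2 artanh y + 6 C (-t)^(1/3)` is nondecreasing, yet unbounded as `t → -∞`.
  have hderiv : ∀ t ≤ t₁, HasDerivWithinAt g
      (y' t / (1 + y t) - -y' t / (1 - y t)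
        + 6 * C * (-1 * (1 / 3) * (-t) ^ ((1 : ℝ) / 3 - 1))) (Set.Iic t₁) t := by
    intro t ht
    obtain ⟨hd, h0, h1, -⟩ := h t ht
    have hpos : -t ≠ 0 := by linarith
    exact (((hd.const_add 1).log (by linarith)).sub
      ((hd.const_sub 1).log (by linarith))).add
      (((hasDerivWithinAt_id t _).neg.rpow_const (Or.inl hpos)).const_mul _)
  have hmono : MonotoneOn g (Set.Iic t₁) := by
    have hsub : interior (Set.Iic t₁) ⊆ Set.Iic t₁ := interior_subset
    refine monotoneOn_of_hasDerivWithinAt_nonneg (convex_Iic t₁)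
      (fun t ht => (hderiv t ht).continuousWithinAt)
      (fun t ht => (hderiv t (hsub ht)).mono hsub) fun t ht => ?_
    obtain ⟨-, h0, h1, hle⟩ := h t (hsub ht)
    have hp : 0 < 1 + y t := by linarith
    have hm : 0 < 1 - y t := by linarith
    have hexp : (1 : ℝ) / 3 - 1 = -2 / 3 := by norm_num
    have hsum : y' t / (1 + y t) - -y' t / (1 - y t) = 2 * (y' t / (1 - y t ^ 2)) := by
      have : 1 - y t ^ 2 = (1 + y t) * (1 - y t) := by ring
      rw [this]
      field_simp
      ring
    have hquot : C * (-t) ^ (-(2 : ℝ) / 3) ≤ y' t / (1 - y t ^ 2) := by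
      rw [le_div_iff₀ (by nlinarith)]
      linarith
    rw [hexp, hsum]
    linarith
  have hlim : Filter.Tendsto (fun t : ℝ => 6 * C * (-t) ^ ((1 : ℝ) / 3))
      Filter.atBot Filter.atTop :=
    ((tendsto_rpow_atTop (by norm_num)).comp
      Filter.tendsto_neg_atBot_atTop).const_mul_atTop (by positivity)
  obtain ⟨t, hgt, ht⟩ :=
    ((hlim.eventually_gt_atTop (g t₁)).and (Filter.eventually_le_atBot t₁)).exists
  obtain ⟨-, h0, h1, -⟩ := h t ht
  have hlog : Real.log (1 - y t) ≤ Real.log (1 + y t) :=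
    Real.log_le_log (by linarith) (by linarith)
  have hle : g t ≤ g t₁ := hmono ht (le_refl t₁) ht
  have hgt' : g t = Real.log (1 + y t) - Real.log (1 - y t)
    + 6 * C * (-t) ^ ((1 : ℝ) / 3) := rfl
  linarith
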